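/- arXiv:2307.02311 — 8 statements merged into one kernel-verified Lean document; each statement's English description precedes it below -/
import Mathlib

section
/- Let L and L' be distinct lines (one-dimensional affine subspaces) in R^3 meeting in exactly one point p, and let P be the affine plane containing L ∪ L'. Then for any line L'' in R^3, the following are equivalent: (i) L'' meets or is parallel to L, and L'' meets or is parallel to L'; (ii) p ∈ L'' or L'' ⊆ P. -/
namespace AffineSubspace

variable {k V Q : Type*} [Field k] [AddCommGroup V] [Module k V] [AddTorsor V Q]

theorem le_of_mem_of_direction_le {M P : AffineSubspace k Q} {q : Q} (hM : q ∈ M) (hP : q ∈ P)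
    (h : M.direction ≤ P.direction) : M ≤ P := fun x hx => by
  have := vadd_mem_of_mem_direction (h (vsub_mem_direction hx hM)) hP
  rwa [vsub_vadd] at this

/-- A line through two distinct points of an affine subspace is contained in it. -/
theorem line_le_of_mem_of_mem [FiniteDimensional k V]
    {M P : AffineSubspace k Q} (hdim : Module.finrank k M.direction = 1)
    {q r : Q} (hqr : q ≠ r) (hqM : q ∈ M) (hrM : r ∈ M) (hqP : q ∈ P) (hrP : r ∈ P) : M ≤ P := by
  refine le_of_mem_of_direction_le hqM hqP ?_
  have hspan : Submodule.span k {q -ᵥ r} = M.direction := by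
    refine Submodule.eq_of_le_of_finrank_le ?_ ?_
    · simpa using vsub_mem_direction hqM hrM
    · rw [hdim, finrank_span_singleton (vsub_ne_zero.2 hqr)]
  rw [← hspan]
  simpa using vsub_mem_direction hqP hrP

/-- Two lines in a plane meet or are parallel. -/
theorem inter_nonempty_or_direction_eq_of_le_plane [FiniteDimensional k V]
    {M N P : AffineSubspace k Q}
    (hM : (M : Set Q).Nonempty) (hN : (N : Set Q).Nonempty)
    (hMdim : Module.finrank k M.direction = 1) (hNdim : Module.finrank k N.direction = 1)
    (hPdim : Module.finrank k P.direction = 2) (hMP : M ≤ P) (hNP : N ≤ P) :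
    ((M : Set Q) ∩ N).Nonempty ∨ M.direction = N.direction := by
  have hle : M.direction ⊔ N.direction ≤ P.direction :=
    sup_le (direction_le hMP) (direction_le hNP)
  by_cases hsup : Module.finrank k ↥(M.direction ⊔ N.direction) ≤ 1
  · right
    exact (Submodule.eq_of_le_of_finrank_le le_sup_left (by rwa [hMdim])).trans
      (Submodule.eq_of_le_of_finrank_le le_sup_right (by rwa [hNdim])).symm
  · left
    have heq := Submodule.eq_of_le_of_finrank_le hle (by lia)
    obtain ⟨a, ha⟩ := hM
    obtain ⟨b, hb⟩ := hN
    have hba : b -ᵥ a ∈ M.direction ⊔ N.direction :=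
      heq ▸ vsub_mem_direction (hNP hb) (hMP ha)
    obtain ⟨m, hm, n, hn, hmn⟩ := Submodule.mem_sup.1 hba
    refine ⟨m +ᵥ a, vadd_mem_of_mem_direction hm ha, ?_⟩
    have hpt : m +ᵥ a = -n +ᵥ b := by
      rw [← vsub_vadd b a, ← hmn, vadd_vadd]
      congr 1
      abel
    rw [hpt]
    exact vadd_mem_of_mem_direction (neg_mem hn) hb

end AffineSubspace

/-- Let `L, L'` be distinct lines in `ℝ³` meeting in exactly one point `p`, and `P` the
plane containing both. A line `L''` meets or is parallel to both `L` and `L'` iff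
`p ∈ L''` or `L'' ⊆ P`. -/
theorem stmt_3 (L L' L'' P : AffineSubspace ℝ (ℝ × ℝ × ℝ))
    (hLne : (L : Set (ℝ × ℝ × ℝ)).Nonempty) (hLdim : Module.finrank ℝ L.direction = 1)
    (hL'ne : (L' : Set (ℝ × ℝ × ℝ)).Nonempty) (hL'dim : Module.finrank ℝ L'.direction = 1)
    (hL''ne : (L'' : Set (ℝ × ℝ × ℝ)).Nonempty) (hL''dim : Module.finrank ℝ L''.direction = 1)
    (hPne : (P : Set (ℝ × ℝ × ℝ)).Nonempty) (hPdim : Module.finrank ℝ P.direction = 2)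
    (hne : L ≠ L') (p : ℝ × ℝ × ℝ)
    (hp : (L : Set (ℝ × ℝ × ℝ)) ∩ (L' : Set (ℝ × ℝ × ℝ)) = {p})
    (hLP : L ≤ P) (hL'P : L' ≤ P) :
    ((((L'' : Set (ℝ × ℝ × ℝ)) ∩ (L : Set (ℝ × ℝ × ℝ))).Nonempty ∨
        L''.direction = L.direction) ∧
      (((L'' : Set (ℝ × ℝ × ℝ)) ∩ (L' : Set (ℝ × ℝ × ℝ))).Nonempty ∨
        L''.direction = L'.direction)) ↔
      (p ∈ L'' ∨ L'' ≤ P) := by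
  obtain ⟨hpL, hpL'⟩ : p ∈ (L : Set (ℝ × ℝ × ℝ)) ∩ L' := hp ▸ Set.mem_singleton p
  constructor
  · rintro ⟨⟨q, hq'', hq⟩ | hd, ⟨r, hr'', hr⟩ | hd'⟩
    · by_cases hqr : q = r
      · subst hqr
        obtain rfl : q = p := hp.subset ⟨hq, hr⟩
        exact Or.inl hq''
      · exact Or.inr (AffineSubspace.line_le_of_mem_of_mem hL''dim hqr hq'' hr'' (hLP hq) (hL'P hr))
    · exact Or.inr (AffineSubspace.le_of_mem_of_direction_le hq'' (hLP hq)
        (hd'.le.trans (AffineSubspace.direction_le hL'P)))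
    · exact Or.inr (AffineSubspace.le_of_mem_of_direction_le hr'' (hL'P hr)
        (hd.le.trans (AffineSubspace.direction_le hLP)))
    · exact absurd (AffineSubspace.ext_of_direction_eq (hd.symm.trans hd') ⟨p, hpL, hpL'⟩) hne
  · rintro (hp'' | hle)
    · exact ⟨Or.inl ⟨p, hp'', hpL⟩, Or.inl ⟨p, hp'', hpL'⟩⟩
    · exact ⟨AffineSubspace.inter_nonempty_or_direction_eq_of_le_plane hL''ne hLne hL''dim hLdim
          hPdim hle hLP,
        AffineSubspace.inter_nonempty_or_direction_eq_of_le_plane hL''ne hL'ne hL''dim hL'dim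
          hPdim hle hL'P⟩
end

section
/- The map Φ : R^7 → R^11 defined by Φ(t, a1, a2, b1, b2, A1, A2) = (a1, a2, b1, b2, A1, A2, t(a1−A1)+b1, t(a2−A2)+b2, t·a1+b1, t·a2+b2, t) is injective and its derivative is injective at every point (Φ is an injective immersion). Its image is the set of tuples ((a1,a2,b1,b2), (A1,A2,B1,B2), p) ∈ R^4 × R^4 × R^3 such that the point p lies on both the chart line of (a1,a2,b1,b2) and the chart line of (A1,A2,B1,B2); hence this incidence set is a smooth 7-dimensional submanifold. -/
/-- `p` lies on the chart line represented by `l = (a1,a2,b1,b2)`,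
i.e. `p = (b1 + t·a1, b2 + t·a2, t)` for some `t`. -/
def onChartLine (l : ℝ × ℝ × ℝ × ℝ) (p : ℝ × ℝ × ℝ) : Prop :=
  ∃ t : ℝ, p = (l.2.2.1 + t * l.1, l.2.2.2 + t * l.2.1, t)

/-- A differentiable map with a differentiable left inverse is an immersion. -/
theorem Function.LeftInverse.injective_fderiv {E F : Type*} [NormedAddCommGroup E]
    [NormedSpace ℝ E] [NormedAddCommGroup F] [NormedSpace ℝ F] {f : E → F} {g : F → E}
    (h : Function.LeftInverse g f) {x : E} (hg : DifferentiableAt ℝ g (f x))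
    (hf : DifferentiableAt ℝ f x) : Function.Injective (fderiv ℝ f x) := by
  have hcomp := fderiv_comp x hg hf
  rw [h.comp_eq_id, fderiv_id] at hcomp
  exact Function.LeftInverse.injective (g := fderiv ℝ g (f x)) fun v =>
    (DFunLike.congr_fun hcomp v).symm

/-- The parametrisation `Φ` of the resolved incidence set `Ĩ(𝕃,𝕃)` is a smooth
injective immersion whose image is exactly the set of triples `(L, L', p)` with `p`
on both chart lines `L` and `L'`. -/
theorem stmt_4
    (Φ : ℝ × ℝ × ℝ × ℝ × ℝ × ℝ × ℝ → (ℝ × ℝ × ℝ × ℝ) × (ℝ × ℝ × ℝ × ℝ) × (ℝ × ℝ × ℝ))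
    (hΦ : ∀ t a1 a2 b1 b2 A1 A2 : ℝ,
      Φ (t, a1, a2, b1, b2, A1, A2) =
        ((a1, a2, b1, b2), (A1, A2, t * (a1 - A1) + b1, t * (a2 - A2) + b2),
          (t * a1 + b1, t * a2 + b2, t))) :
    Function.Injective Φ ∧
    ContDiff ℝ (⊤ : ℕ∞) Φ ∧
    (∀ x, Function.Injective (fderiv ℝ Φ x)) ∧
    Set.range Φ =
      {q : (ℝ × ℝ × ℝ × ℝ) × (ℝ × ℝ × ℝ × ℝ) × (ℝ × ℝ × ℝ) |
        onChartLine q.1 q.2.2 ∧ onChartLine q.2.1 q.2.2} := by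
  have hleft : Function.LeftInverse
      (fun q => (q.2.2.2.2, q.1.1, q.1.2.1, q.1.2.2.1, q.1.2.2.2, q.2.1.1, q.2.1.2.1)) Φ := by
    rintro ⟨t, a1, a2, b1, b2, A1, A2⟩
    simp only [hΦ]
  have hsmooth : ContDiff ℝ (⊤ : ℕ∞) Φ := by
    have hfun : Φ = fun x => Φ (x.1, x.2.1, x.2.2.1, x.2.2.2.1, x.2.2.2.2.1, x.2.2.2.2.2.1,
        x.2.2.2.2.2.2) := rfl
    rw [hfun]
    simp only [hΦ]
    fun_prop
  refine ⟨hleft.injective, hsmooth, fun x => hleft.injective_fderiv (by fun_prop)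
    (hsmooth.differentiable (by simp) x), ?_⟩
  ext ⟨⟨a1, a2, b1, b2⟩, ⟨A1, A2, B1, B2⟩, ⟨p1, p2, p3⟩⟩
  simp only [Set.mem_range, Set.mem_ofPred_eq, onChartLine, Prod.exists, hΦ, Prod.mk.injEq]
  constructor
  · rintro ⟨t, _, _, _, _, _, _, ⟨rfl, rfl, rfl, rfl⟩, ⟨rfl, rfl, rfl, rfl⟩, rfl, rfl, rfl⟩
    exact ⟨⟨t, by ring, by ring, rfl⟩, ⟨t, by ring, by ring, rfl⟩⟩
  · rintro ⟨⟨t, h1, h2, rfl⟩, ⟨_, h3, h4, rfl⟩⟩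
    exact ⟨p3, a1, a2, b1, b2, A1, A2, ⟨rfl, rfl, rfl, rfl⟩,
      ⟨rfl, rfl, by linarith, by linarith⟩, by linarith, by linarith, rfl⟩
end

section
/- Let Q_C be the complex quadratic form on C^4 given by Q_C(z1,z2,z3,z4) = z1·z4 − z2·z3, and for t ∈ C let W_t^C = span_C{(1,0,−t,0),(0,1,0,−t)}. Suppose x, x' ∈ C^4 are linearly independent over C, x ∈ W_t^C \ {0} and x' ∈ W_{t'}^C \ {0} for some t, t' ∈ C. Let ℓ = span_C{x, x'} ⊆ C^4, and assume: (i) ℓ is real, i.e. ℓ is stable under componentwise complex conjugation; and (ii) every z ∈ ℓ with Q_C(z) = 0 is a complex scalar multiple of x or of x'. Then t + t' is real. (Hence the midpoint of the two, possibly complex, focal points of a congruence along a real tangent line is always real.) -/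
open ComplexConjugate

/-- The complexified generator `W_t^ℂ = span_ℂ{(1,0,−t,0),(0,1,0,−t)}`. -/
noncomputable def WC (t : ℂ) : Submodule ℂ (ℂ × ℂ × ℂ × ℂ) :=
  Submodule.span ℂ {((1:ℂ), (0:ℂ), -t, (0:ℂ)), ((0:ℂ), (1:ℂ), (0:ℂ), -t)}

/-- Componentwise complex conjugation on `ℂ⁴`. -/
def conj4 (z : ℂ × ℂ × ℂ × ℂ) : ℂ × ℂ × ℂ × ℂ :=
  (conj z.1, conj z.2.1, conj z.2.2.1, conj z.2.2.2)

theorem mem_WC_iff {t : ℂ} {x : ℂ × ℂ × ℂ × ℂ} :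
    x ∈ WC t ↔ x.2.2.1 = -t * x.1 ∧ x.2.2.2 = -t * x.2.1 := by
  obtain ⟨p, q, u, v⟩ := x
  rw [WC, Submodule.mem_span_pair]
  constructor
  · rintro ⟨a, b, h⟩
    simp only [Prod.smul_mk, Prod.mk_add_mk, smul_eq_mul, Prod.mk.injEq] at h
    obtain ⟨h1, h2, h3, h4⟩ := h
    constructor
    · linear_combination -h3 - t * h1
    · linear_combination -h4 - t * h2
  · rintro ⟨h1, h2⟩
    simp only at h1 h2
    refine ⟨p, q, ?_⟩
    simp [h1, h2, mul_comm]

theorem conj4_mem_WC {t : ℂ} {x : ℂ × ℂ × ℂ × ℂ} (hx : x ∈ WC t) :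
    conj4 x ∈ WC (conj t) := by
  rw [mem_WC_iff] at hx ⊢
  simp [conj4, hx.1, hx.2]

theorem conj4_ne_zero {x : ℂ × ℂ × ℂ × ℂ} (hx : x ≠ 0) : conj4 x ≠ 0 := by
  contrapose! hx
  simpa [conj4, Prod.ext_iff] using hx

/-- Distinct generators of the quadric meet only in `0`. -/
theorem eq_of_mem_WC {s t : ℂ} {x : ℂ × ℂ × ℂ × ℂ} (hx0 : x ≠ 0)
    (hs : x ∈ WC s) (ht : x ∈ WC t) : s = t := by
  rw [mem_WC_iff] at hs ht
  by_contra hst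
  have hst' : s - t ≠ 0 := sub_ne_zero.mpr hst
  have h1 : x.1 = 0 := (mul_eq_zero.mp
    (show (s - t) * x.1 = 0 by linear_combination hs.1 - ht.1)).resolve_left hst'
  have h2 : x.2.1 = 0 := (mul_eq_zero.mp
    (show (s - t) * x.2.1 = 0 by linear_combination hs.2 - ht.2)).resolve_left hst'
  exact hx0 (by simp [Prod.ext_iff, hs.1, hs.2, h1, h2])

theorem quadric_eq_zero_of_mem_WC {t : ℂ} {x : ℂ × ℂ × ℂ × ℂ} (hx : x ∈ WC t) :
    x.1 * x.2.2.2 - x.2.1 * x.2.2.1 = 0 := by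
  rw [mem_WC_iff] at hx
  rw [hx.1, hx.2]
  ring

/-- If a line `ℓ = span_ℂ{x, x'}` in `ℂ⁴`, with `x ∈ W_t^ℂ` and `x' ∈ W_{t'}^ℂ` nonzero
and independent, is real (stable under conjugation) and meets the quadric
`z1·z4 − z2·z3 = 0` only in multiples of `x` and `x'`, then `t + t'` is real: the
midpoint of the two (possibly complex) focal points is real. -/
theorem stmt_10 (t t' : ℂ) (x x' : ℂ × ℂ × ℂ × ℂ)
    (hind : LinearIndependent ℂ ![x, x'])
    (hx : x ∈ WC t) (hx0 : x ≠ 0)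
    (hx' : x' ∈ WC t') (hx'0 : x' ≠ 0)
    (hreal : ∀ z ∈ Submodule.span ℂ {x, x'}, conj4 z ∈ Submodule.span ℂ {x, x'})
    (hquad : ∀ z ∈ Submodule.span ℂ {x, x'},
      z.1 * z.2.2.2 - z.2.1 * z.2.2.1 = 0 →
        (∃ c : ℂ, z = c • x) ∨ (∃ c : ℂ, z = c • x')) :
    (t + t').im = 0 := by
  have key : ∀ s : ℂ, ∀ y ∈ Submodule.span ℂ {x, x'}, y ≠ 0 → y ∈ WC s →
      conj s = t ∨ conj s = t' := by
    intro s y hy hy0 hys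
    have hconj := conj4_mem_WC hys
    have hne := conj4_ne_zero hy0
    rcases hquad _ (hreal y hy) (quadric_eq_zero_of_mem_WC hconj) with ⟨c, hc⟩ | ⟨c, hc⟩
    · exact .inl (eq_of_mem_WC hne hconj (hc ▸ (WC t).smul_mem c hx))
    · exact .inr (eq_of_mem_WC hne hconj (hc ▸ (WC t').smul_mem c hx'))
  have h := key t x (Submodule.subset_span (by simp)) hx0 hx
  have h' := key t' x' (Submodule.subset_span (by simp)) hx'0 hx'
  simp only [Complex.ext_iff, Complex.conj_re, Complex.conj_im] at h h'
  rw [Complex.add_im]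
  grind
end

section
/- Let (A1,A2,B1,B2) ∈ R^4 \ {0} with A1·B2 − A2·B1 = 0 (so the corresponding chart line L' meets or is parallel to the line L0 given by the origin of the chart), and define F : R^4 → R by F(a1,a2,b1,b2) = (A1−a1)(B2−b2) − (A2−a2)(B1−b1), whose zero set is the set of chart lines meeting or parallel to L'. Then F(0) = 0, the gradient of F at the origin is (−B2, B1, A2, −A1) ≠ 0, and the kernel of the derivative of F at the origin equals the set {v ∈ R^4 : B_Q(v, (A1,A2,B1,B2)) = 0}, where B_Q is the symmetric bilinear form polar to Q (B_Q(x,x) = Q(x)). That is, the tangent hyperplane at L0 to the set of lines meeting L' is the polar hyperplane of L' with respect to the quadric Q. -/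
/-- The derivative at the origin of the incidence function of the chart line `(A1,A2,B1,B2)`. -/
theorem fderiv_incidence_zero_apply (A1 A2 B1 B2 : ℝ) (v : ℝ × ℝ × ℝ × ℝ) :
    fderiv ℝ (fun x : ℝ × ℝ × ℝ × ℝ =>
      (A1 - x.1) * (B2 - x.2.2.2) - (A2 - x.2.1) * (B1 - x.2.2.1)) 0 v =
      -B2 * v.1 + B1 * v.2.1 + A2 * v.2.2.1 + -A1 * v.2.2.2 := by
  have hid := hasFDerivAt_id (𝕜 := ℝ) (0 : ℝ × ℝ × ℝ × ℝ)
  have h := ((hid.fst.const_sub A1).mul (hid.snd.snd.snd.const_sub B2)).sub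
    ((hid.snd.fst.const_sub A2).mul (hid.snd.snd.fst.const_sub B1))
  refine (DFunLike.congr_fun h.fderiv v).trans ?_
  simp
  ring

/-- For `(A1,A2,B1,B2) ≠ 0` on the cone `A1·B2 − A2·B1 = 0`, the function
`F(a1,a2,b1,b2) = (A1−a1)(B2−b2) − (A2−a2)(B1−b1)` vanishes at the origin, has
gradient `(−B2, B1, A2, −A1) ≠ 0` there, and the kernel of its derivative at the
origin is the polar hyperplane of `(A1,A2,B1,B2)` with respect to the quadric `Q`,
where `B_Q(x,y) = (x1·y4 + x4·y1 − x2·y3 − x3·y2)/2`. -/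
theorem stmt_15 (A1 A2 B1 B2 : ℝ)
    (hne : ((A1, A2, B1, B2) : ℝ × ℝ × ℝ × ℝ) ≠ 0)
    (hQ : A1 * B2 - A2 * B1 = 0)
    (F : ℝ × ℝ × ℝ × ℝ → ℝ)
    (hF : ∀ x : ℝ × ℝ × ℝ × ℝ,
      F x = (A1 - x.1) * (B2 - x.2.2.2) - (A2 - x.2.1) * (B1 - x.2.2.1)) :
    F 0 = 0 ∧
    (∀ v : ℝ × ℝ × ℝ × ℝ,
      fderiv ℝ F 0 v = -B2 * v.1 + B1 * v.2.1 + A2 * v.2.2.1 + -A1 * v.2.2.2) ∧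
    ((-B2, B1, A2, -A1) : ℝ × ℝ × ℝ × ℝ) ≠ 0 ∧
    {v : ℝ × ℝ × ℝ × ℝ | fderiv ℝ F 0 v = 0} =
      {v : ℝ × ℝ × ℝ × ℝ |
        (v.1 * B2 + v.2.2.2 * A1 - v.2.1 * B1 - v.2.2.1 * A2) / 2 = 0} := by
  obtain rfl : F = fun x => (A1 - x.1) * (B2 - x.2.2.2) - (A2 - x.2.1) * (B1 - x.2.2.1) :=
    funext hF
  refine ⟨by simpa using hQ, fderiv_incidence_zero_apply A1 A2 B1 B2, ?_, ?_⟩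
  · contrapose! hne
    simp_all
  · ext v
    simp only [Set.mem_ofPred_eq, fderiv_incidence_zero_apply]
    constructor <;> intro h <;> linarith
end

section
/- Let b1, b2 : R^2 → R be smooth with b1(0,0) = b2(0,0) = 0, and define f : R^2 → R by f(u,v) = u·b2(u,v) − v·b1(u,v) (the contact function at L0 of the congruence (u,v,b1,b2) with the set of lines meeting L0). Then f(0,0) = 0, the derivative of f at (0,0) vanishes, and the determinant of the Hessian matrix of f at (0,0) equals −[(b2v − b1u)² + 4·b1v·b2u], all partial derivatives evaluated at (0,0). In particular, f has a nondegenerate (Morse) critical point at the origin if and only if (0,0) is not a parabolic point of the congruence, i.e. (b2v − b1u)² + 4·b1v·b2u ≠ 0. -/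
/-- The derivative of the contact function `(u, v) ↦ u * b2 (u, v) - v * b1 (u, v)` in the
direction `w`. -/
theorem fderiv_contact_apply {b1 b2 : ℝ × ℝ → ℝ} {p : ℝ × ℝ}
    (hb1 : DifferentiableAt ℝ b1 p) (hb2 : DifferentiableAt ℝ b2 p) (w : ℝ × ℝ) :
    fderiv ℝ (fun p : ℝ × ℝ => p.1 * b2 p - p.2 * b1 p) p w =
      w.1 * b2 p + p.1 * fderiv ℝ b2 p w - (w.2 * b1 p + p.2 * fderiv ℝ b1 p w) := by
  have h := ((hasFDerivAt_fst (𝕜 := ℝ) (p := p)).mul hb2.hasFDerivAt).sub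
    ((hasFDerivAt_snd (𝕜 := ℝ) (p := p)).mul hb1.hasFDerivAt)
  refine (congrArg (fun L : ℝ × ℝ →L[ℝ] ℝ => L w) h.fderiv).trans ?_
  simp
  ring

/-- The second derivative of the contact function at the origin: the second derivatives of
`b1` and `b2` do not contribute. -/
theorem fderiv_fderiv_contact_zero {b1 b2 : ℝ × ℝ → ℝ}
    (hb1 : ContDiff ℝ 2 b1) (hb2 : ContDiff ℝ 2 b2) (w z : ℝ × ℝ) :
    fderiv ℝ (fun p => fderiv ℝ (fun p : ℝ × ℝ => p.1 * b2 p - p.2 * b1 p) p w) (0, 0) z =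
      w.1 * fderiv ℝ b2 (0, 0) z + z.1 * fderiv ℝ b2 (0, 0) w -
        (w.2 * fderiv ℝ b1 (0, 0) z + z.2 * fderiv ℝ b1 (0, 0) w) := by
  have d1 : Differentiable ℝ b1 := hb1.differentiable (by norm_num)
  have d2 : Differentiable ℝ b2 := hb2.differentiable (by norm_num)
  have e1 : Differentiable ℝ (fun p => fderiv ℝ b1 p w) :=
    ((hb1.fderiv_right (m := 1) (by norm_num)).differentiable (by norm_num)).clm_apply
      (differentiable_const w)
  have e2 : Differentiable ℝ (fun p => fderiv ℝ b2 p w) :=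
    ((hb2.fderiv_right (m := 1) (by norm_num)).differentiable (by norm_num)).clm_apply
      (differentiable_const w)
  simp only [fun p => fderiv_contact_apply (d1 p) (d2 p) w]
  have h := (((d2 (0, 0)).hasFDerivAt.const_mul w.1).add
      ((hasFDerivAt_fst (𝕜 := ℝ) (p := ((0 : ℝ), (0 : ℝ)))).mul (e2 (0, 0)).hasFDerivAt)).sub
    (((d1 (0, 0)).hasFDerivAt.const_mul w.2).add
      ((hasFDerivAt_snd (𝕜 := ℝ) (p := ((0 : ℝ), (0 : ℝ)))).mul (e1 (0, 0)).hasFDerivAt))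
  refine (congrArg (fun L : ℝ × ℝ →L[ℝ] ℝ => L z) h.fderiv).trans ?_
  simp
  ring


/-- The contact function `f(u,v) = u·b2(u,v) − v·b1(u,v)` of a congruence
`(u,v,b1,b2)` with the set of lines meeting `L0` has a critical point at the origin
whose Hessian determinant is `−[(b2v − b1u)² + 4·b1v·b2u]`; in particular the critical
point is nondegenerate (Morse) iff the origin is not a parabolic point, i.e.
`(b2v − b1u)² + 4·b1v·b2u ≠ 0`. -/
theorem stmt_16 (b1 b2 : ℝ × ℝ → ℝ)
    (hb1 : ContDiff ℝ (⊤ : ℕ∞) b1) (hb2 : ContDiff ℝ (⊤ : ℕ∞) b2)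
    (hb10 : b1 (0, 0) = 0) (hb20 : b2 (0, 0) = 0)
    (f : ℝ × ℝ → ℝ)
    (hf : ∀ u v : ℝ, f (u, v) = u * b2 (u, v) - v * b1 (u, v))
    (b1u b1v b2u b2v : ℝ)
    (hb1u : b1u = fderiv ℝ b1 (0, 0) (1, 0)) (hb1v : b1v = fderiv ℝ b1 (0, 0) (0, 1))
    (hb2u : b2u = fderiv ℝ b2 (0, 0) (1, 0)) (hb2v : b2v = fderiv ℝ b2 (0, 0) (0, 1)) :
    f (0, 0) = 0 ∧
    fderiv ℝ f (0, 0) = 0 ∧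
    (fderiv ℝ (fun p => fderiv ℝ f p (1, 0)) (0, 0) (1, 0)) *
        (fderiv ℝ (fun p => fderiv ℝ f p (0, 1)) (0, 0) (0, 1)) -
      (fderiv ℝ (fun p => fderiv ℝ f p (1, 0)) (0, 0) (0, 1)) *
        (fderiv ℝ (fun p => fderiv ℝ f p (0, 1)) (0, 0) (1, 0)) =
      -((b2v - b1u) ^ 2 + 4 * b1v * b2u) ∧
    ((fderiv ℝ (fun p => fderiv ℝ f p (1, 0)) (0, 0) (1, 0)) *
          (fderiv ℝ (fun p => fderiv ℝ f p (0, 1)) (0, 0) (0, 1)) -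
        (fderiv ℝ (fun p => fderiv ℝ f p (1, 0)) (0, 0) (0, 1)) *
          (fderiv ℝ (fun p => fderiv ℝ f p (0, 1)) (0, 0) (1, 0)) ≠ 0 ↔
      (b2v - b1u) ^ 2 + 4 * b1v * b2u ≠ 0) := by
  obtain rfl : f = fun p => p.1 * b2 p - p.2 * b1 p := funext fun p => hf p.1 p.2
  have c1 : ContDiff ℝ 2 b1 := contDiff_infty.1 hb1 2
  have c2 : ContDiff ℝ 2 b2 := contDiff_infty.1 hb2 2
  have hess := fderiv_fderiv_contact_zero c1 c2
  refine ⟨by simp, ?_, ?_, ?_⟩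
  · ext <;>
      simp [fderiv_contact_apply (c1.differentiable (by norm_num) (0, 0))
        (c2.differentiable (by norm_num) (0, 0)), hb10, hb20]
  · simp only [hess, ← hb1u, ← hb1v, ← hb2u, ← hb2v]
    ring
  · rw [← neg_ne_zero (a := (b2v - b1u) ^ 2 + 4 * b1v * b2u)]
    simp only [hess, ← hb1u, ← hb1v, ← hb2u, ← hb2v]
    ring_nf
end

section
/- Let b1, b2 : R^2 → R be smooth and suppose at the origin: b1u = b2u = b2v = 0, b1v ≠ 0, and b2uv ≠ 0. Define g(u,v,t) = t² + t·(b1u + b2v)(u,v) + (b1u·b2v − b1v·b2u)(u,v), and suppose h : R^2 → R is a smooth function on a neighbourhood of (0,0) with h(0,0) = 0 and g(u, h(u,t), t) = 0 for all (u,t) near (0,0). Define the focal-surface parametrisation ψ(u,t) = (b1(u,h(u,t)), b2(u,h(u,t)), 0) + t·(u, h(u,t), 1). Then: ∂h/∂t(0,0) = 0; ∂h/∂u(0,0) = −b2uu(0,0)/b2uv(0,0); ∂ψ/∂t(0,0) = (0,0,1); and ∂ψ/∂u(0,0) = (b1v(0,0)·∂h/∂u(0,0), 0, 0). Consequently ψ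 is an immersion at (0,0) (the focal surface is regular there) if and only if b2uu(0,0) ≠ 0. -/
/-- Chain rule along the graph map `(u, t) ↦ (u, h (u, t))` at the origin. -/
lemma hasFDerivAt_comp_graph {f h : ℝ × ℝ → ℝ} (hf : DifferentiableAt ℝ f (0, 0))
    (hh : DifferentiableAt ℝ h (0, 0)) (hh0 : h (0, 0) = 0) :
    HasFDerivAt (fun p : ℝ × ℝ => f (p.1, h p))
      ((fderiv ℝ f (0, 0)).comp
        ((ContinuousLinearMap.fst ℝ ℝ ℝ).prod (fderiv ℝ h (0, 0)))) (0, 0) := by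
  have hγ : HasFDerivAt (fun p : ℝ × ℝ => (p.1, h p))
      ((ContinuousLinearMap.fst ℝ ℝ ℝ).prod (fderiv ℝ h (0, 0))) (0, 0) :=
    hasFDerivAt_fst.prodMk hh.hasFDerivAt
  refine HasFDerivAt.comp (g := f) (0, 0) ?_ hγ
  simpa only [hh0] using hf.hasFDerivAt

lemma differentiable_fderiv_apply {f fw : ℝ × ℝ → ℝ} {w : ℝ × ℝ}
    (hf : ContDiff ℝ (⊤ : ℕ∞) f) (hfw : ∀ p, fw p = fderiv ℝ f p w) :
    Differentiable ℝ fw := by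
  rw [funext hfw]
  have : ContDiff ℝ 1 (fderiv ℝ f) := hf.fderiv_right (WithTop.coe_le_coe.2 le_top)
  exact (this.differentiable one_ne_zero).clm_apply (differentiable_const w)

lemma map_prod_eq (L : ℝ × ℝ →L[ℝ] ℝ) (a b : ℝ) :
    L (a, b) = a * L (1, 0) + b * L (0, 1) := by
  rw [← smul_eq_mul, ← smul_eq_mul, ← map_smul, ← map_smul, ← map_add]
  simp

/-- At a parabolic point normalised so that `b1u = b2u = b2v = 0`, `b1v ≠ 0`,
`b2uv ≠ 0` at the origin, if `v = h(u,t)` solves the focal equation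
`g(u, h(u,t), t) = 0` near the origin with `h(0,0) = 0`, and
`ψ(u,t) = (b1(u,h(u,t)), b2(u,h(u,t)), 0) + t·(u, h(u,t), 1)` parametrises the focal
surface, then `h_t(0,0) = 0`, `h_u(0,0) = −b2uu/b2uv`, `ψ_t(0,0) = (0,0,1)`,
`ψ_u(0,0) = (b1v·h_u(0,0), 0, 0)`; hence `ψ` is an immersion at the origin iff
`b2uu(0,0) ≠ 0`. -/
theorem stmt_17 (b1 b2 : ℝ × ℝ → ℝ)
    (hb1 : ContDiff ℝ (⊤ : ℕ∞) b1) (hb2 : ContDiff ℝ (⊤ : ℕ∞) b2)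
    (b1u b1v b2u b2v : ℝ × ℝ → ℝ)
    (hb1u : ∀ p, b1u p = fderiv ℝ b1 p (1, 0)) (hb1v : ∀ p, b1v p = fderiv ℝ b1 p (0, 1))
    (hb2u : ∀ p, b2u p = fderiv ℝ b2 p (1, 0)) (hb2v : ∀ p, b2v p = fderiv ℝ b2 p (0, 1))
    (h1 : b1u (0, 0) = 0) (h2 : b2u (0, 0) = 0) (h3 : b2v (0, 0) = 0)
    (h4 : b1v (0, 0) ≠ 0)
    (h5 : fderiv ℝ b2u (0, 0) (0, 1) ≠ 0)
    (g : ℝ × ℝ × ℝ → ℝ)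
    (hg : ∀ u v t : ℝ, g (u, v, t) =
      t ^ 2 + t * (b1u (u, v) + b2v (u, v)) +
        (b1u (u, v) * b2v (u, v) - b1v (u, v) * b2u (u, v)))
    (h : ℝ × ℝ → ℝ) (hh : ContDiff ℝ (⊤ : ℕ∞) h) (hh0 : h (0, 0) = 0)
    (U : Set (ℝ × ℝ)) (hU : U ∈ nhds ((0:ℝ), (0:ℝ)))
    (hgh : ∀ p ∈ U, g (p.1, h p, p.2) = 0)
    (ψ : ℝ × ℝ → ℝ × ℝ × ℝ)
    (hψ : ∀ u t : ℝ, ψ (u, t) =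
      (b1 (u, h (u, t)) + t * u, b2 (u, h (u, t)) + t * h (u, t), t)) :
    fderiv ℝ h (0, 0) (0, 1) = 0 ∧
    fderiv ℝ h (0, 0) (1, 0) =
      -(fderiv ℝ b2u (0, 0) (1, 0)) / fderiv ℝ b2u (0, 0) (0, 1) ∧
    fderiv ℝ ψ (0, 0) (0, 1) = (0, 0, 1) ∧
    fderiv ℝ ψ (0, 0) (1, 0) = (b1v (0, 0) * fderiv ℝ h (0, 0) (1, 0), 0, 0) ∧
    (Function.Injective (fderiv ℝ ψ (0, 0)) ↔ fderiv ℝ b2u (0, 0) (1, 0) ≠ 0) := by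
  have hhd : DifferentiableAt ℝ h (0, 0) := hh.differentiable (by simp) _
  have hb1d : DifferentiableAt ℝ b1 (0, 0) := hb1.differentiable (by simp) _
  have hb2d : DifferentiableAt ℝ b2 (0, 0) := hb2.differentiable (by simp) _
  have A1 := hasFDerivAt_comp_graph (differentiable_fderiv_apply hb1 hb1u _) hhd hh0
  have A2 := hasFDerivAt_comp_graph (differentiable_fderiv_apply hb1 hb1v _) hhd hh0
  have A3 := hasFDerivAt_comp_graph (differentiable_fderiv_apply hb2 hb2u _) hhd hh0
  have A4 := hasFDerivAt_comp_graph (differentiable_fderiv_apply hb2 hb2v _) hhd hh0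
  have T : HasFDerivAt (fun p : ℝ × ℝ => p.2) (ContinuousLinearMap.snd ℝ ℝ ℝ) (0, 0) :=
    hasFDerivAt_snd
  have S : HasFDerivAt (fun p : ℝ × ℝ => p.1) (ContinuousLinearMap.fst ℝ ℝ ℝ) (0, 0) :=
    hasFDerivAt_fst
  have G := ((T.mul T).add (T.mul (A1.add A4))).add ((A1.mul A4).sub (A2.mul A3))
  have E := G.unique <|
    (hasFDerivAt_const (0 : ℝ) ((0 : ℝ), (0 : ℝ))).congr_of_eventuallyEq <| by
      filter_upwards [hU] with p hp
      have := hgh p hp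
      rw [hg] at this
      simpa [pow_two] using this
  have Et := congrArg (fun L : ℝ × ℝ →L[ℝ] ℝ => L (0, 1)) E
  have Eu := congrArg (fun L : ℝ × ℝ →L[ℝ] ℝ => L (1, 0)) E
  simp [hh0, h1, h2, h3, h4] at Et Eu
  rw [map_prod_eq] at Et Eu
  have ht : fderiv ℝ h (0, 0) (0, 1) = 0 := by simpa [h5] using Et
  have hu : fderiv ℝ h (0, 0) (1, 0) =
      -(fderiv ℝ b2u (0, 0) (1, 0)) / fderiv ℝ b2u (0, 0) (0, 1) := by
    rw [eq_div_iff h5]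
    linarith
  have P : HasFDerivAt ψ _ (0, 0) :=
    (((hasFDerivAt_comp_graph hb1d hhd hh0).add (T.mul S)).prodMk
      (((hasFDerivAt_comp_graph hb2d hhd hh0).add (T.mul hhd.hasFDerivAt)).prodMk
        T)).congr_of_eventuallyEq (Filter.Eventually.of_forall fun p => hψ p.1 p.2)
  rw [hb1u] at h1
  rw [hb2u] at h2
  rw [hb2v] at h3
  have hψ' (a b : ℝ) : fderiv ℝ ψ (0, 0) (a, b) =
      (a * (b1v (0, 0) * fderiv ℝ h (0, 0) (1, 0)), 0, b) := by
    rw [P.fderiv]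
    have hb1' (x y : ℝ) : fderiv ℝ b1 (0, 0) (x, y) = y * b1v (0, 0) := by
      rw [map_prod_eq]; simp [h1, hb1v]
    have hb2' (x y : ℝ) : fderiv ℝ b2 (0, 0) (x, y) = 0 := by
      rw [map_prod_eq]; simp [h2, h3]
    have hh' : fderiv ℝ h (0, 0) (a, b) = a * fderiv ℝ h (0, 0) (1, 0) := by
      rw [map_prod_eq]; simp [ht]
    simp [hh0, hb1', hb2', hh']
    ring
  refine ⟨ht, hu, by simp [hψ'], by simp [hψ'], ?_⟩
  have key : fderiv ℝ b2u (0, 0) (1, 0) ≠ 0 ↔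
      b1v (0, 0) * fderiv ℝ h (0, 0) (1, 0) ≠ 0 := by
    simp [hu, h4, h5]
  rw [key, injective_iff_map_eq_zero]
  constructor
  · intro hinj h0
    simpa using hinj (1, 0) (by simp [hψ', h0])
  · rintro hne ⟨a, b⟩ hab
    rw [hψ'] at hab
    simp only [Prod.mk_eq_zero, mul_eq_zero_iff_right hne] at hab
    simp [hab]
end

section
/- Let b2 : R^2 → R and h : R^2 → R be smooth with b2(0,0) = 0, ∂b2/∂u(0,0) = 0, ∂b2/∂v(0,0) = 0, h(0,0) = 0 and ∂h/∂t(0,0) = 0 (h viewed as a function of (u,t)). Define H(u,t) = b2(u, h(u,t)) + t·h(u,t), the height function measuring the contact of the focal surface with its tangent plane {x2 = 0}. Then H(0,0) = 0, the derivative of H at (0,0) vanishes, H_tt(0,0) = 0, H_ut(0,0) = ∂h/∂u(0,0), and the determinant of the Hessian of H at (0,0) equals −(∂h/∂u(0,0))². In particular, if ∂h/∂u(0,0) ≠ 0 then H has a nondegenerate critical point of saddle type (A1⁻) at the origin; hence every regular point of the focal surface on the image of the parabolic curve is a hyperbolic point of the focal surface. -/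
/-- A continuous linear functional on `ℝ × ℝ` vanishing on the standard basis is zero. -/
lemma clm_prod_eq_zero {L : ℝ × ℝ →L[ℝ] ℝ} (h₁ : L (1, 0) = 0) (h₂ : L (0, 1) = 0) : L = 0 := by
  ext <;> simp [h₁, h₂]

section HeightFunction

variable {b h : ℝ × ℝ → ℝ}

/-- The first derivative of `(u, t) ↦ b (u, h (u, t)) + t * h (u, t)`. -/
lemma fderiv_height (hb : Differentiable ℝ b) (hh : Differentiable ℝ h) (p w : ℝ × ℝ) :
    fderiv ℝ (fun q : ℝ × ℝ => b (q.1, h q) + q.2 * h q) p w =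
      fderiv ℝ b (p.1, h p) (w.1, fderiv ℝ h p w) + (p.2 * fderiv ℝ h p w + w.2 * h p) := by
  have hφ : HasFDerivAt (fun q : ℝ × ℝ => (q.1, h q)) _ p :=
    hasFDerivAt_fst.prodMk (hh p).hasFDerivAt
  have hcomp : HasFDerivAt (fun q : ℝ × ℝ => b (q.1, h q)) _ p :=
    (hb (p.1, h p)).hasFDerivAt.comp p hφ
  have hmul : HasFDerivAt (fun q : ℝ × ℝ => q.2 * h q) _ p :=
    hasFDerivAt_snd.mul (hh p).hasFDerivAt
  have key : HasFDerivAt (fun q : ℝ × ℝ => b (q.1, h q) + q.2 * h q) _ p := hcomp.add hmul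
  rw [key.fderiv]
  simp [mul_comm]

/-- The second derivative of `(u, t) ↦ b (u, h (u, t)) + t * h (u, t)` at the origin, when `b` has
a critical point there and `h` vanishes there. -/
lemma fderiv_fderiv_height (hb : ContDiff ℝ 2 b) (hh : ContDiff ℝ 2 h)
    (hb' : fderiv ℝ b (0, 0) = 0) (hh0 : h (0, 0) = 0) (w z : ℝ × ℝ) :
    fderiv ℝ (fun p => fderiv ℝ (fun q : ℝ × ℝ => b (q.1, h q) + q.2 * h q) p w) (0, 0) z =
      fderiv ℝ (fderiv ℝ b) (0, 0) (z.1, fderiv ℝ h (0, 0) z) (w.1, fderiv ℝ h (0, 0) w) +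
        (z.2 * fderiv ℝ h (0, 0) w + w.2 * fderiv ℝ h (0, 0) z) := by
  have hbd := hb.differentiable two_ne_zero
  have hhd := hh.differentiable two_ne_zero
  have hb1 : Differentiable ℝ (fderiv ℝ b) :=
    (hb.fderiv_right (m := 1) (by norm_num)).differentiable one_ne_zero
  have hh1 : Differentiable ℝ (fderiv ℝ h) :=
    (hh.fderiv_right (m := 1) (by norm_num)).differentiable one_ne_zero
  simp_rw [fderiv_height hbd hhd]
  have hφ : HasFDerivAt (fun q : ℝ × ℝ => (q.1, h q)) _ (0, 0) :=
    hasFDerivAt_fst.prodMk (hhd (0, 0)).hasFDerivAt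
  have hc : HasFDerivAt (fun q : ℝ × ℝ => fderiv ℝ b (q.1, h q)) _ (0, 0) :=
    (hb1 (0, h (0, 0))).hasFDerivAt.comp (0, 0) hφ
  have hw : HasFDerivAt (fun q => fderiv ℝ h q w) _ (0, 0) :=
    (hh1 (0, 0)).hasFDerivAt.clm_apply (hasFDerivAt_const w _)
  have hv : HasFDerivAt (fun q => (w.1, fderiv ℝ h q w)) _ (0, 0) :=
    (hasFDerivAt_const w.1 _).prodMk hw
  have hm : HasFDerivAt (fun q : ℝ × ℝ => q.2 * fderiv ℝ h q w) _ (0, 0) :=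
    hasFDerivAt_snd.mul hw
  have hl : HasFDerivAt (fun q => w.2 * h q) _ (0, 0) :=
    (hhd (0, 0)).hasFDerivAt.const_mul w.2
  have key := (hc.clm_apply hv).add (hm.add hl)
  refine (congrArg (· z) key.fderiv).trans ?_
  simp [hh0, hb', mul_comm]

end HeightFunction


/-- The height function `H(u,t) = b2(u, h(u,t)) + t·h(u,t)` measuring the contact of
the focal surface with its tangent plane `{x2 = 0}` has a critical point at the
origin with `H_tt = 0`, `H_ut = h_u(0,0)` and Hessian determinant `−h_u(0,0)²`; in
particular if `h_u(0,0) ≠ 0` then the critical point is a nondegenerate saddle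
(`A1⁻`), so every regular point of the focal surface on the image of the parabolic
curve is hyperbolic. -/
theorem stmt_18 (b2 h : ℝ × ℝ → ℝ)
    (hb2 : ContDiff ℝ (⊤ : ℕ∞) b2) (hh : ContDiff ℝ (⊤ : ℕ∞) h)
    (hb20 : b2 (0, 0) = 0)
    (hb2u : fderiv ℝ b2 (0, 0) (1, 0) = 0)
    (hb2v : fderiv ℝ b2 (0, 0) (0, 1) = 0)
    (hh0 : h (0, 0) = 0)
    (hht : fderiv ℝ h (0, 0) (0, 1) = 0)
    (H : ℝ × ℝ → ℝ)
    (hH : ∀ u t : ℝ, H (u, t) = b2 (u, h (u, t)) + t * h (u, t)) :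
    H (0, 0) = 0 ∧
    fderiv ℝ H (0, 0) = 0 ∧
    fderiv ℝ (fun p => fderiv ℝ H p (0, 1)) (0, 0) (0, 1) = 0 ∧
    fderiv ℝ (fun p => fderiv ℝ H p (0, 1)) (0, 0) (1, 0) = fderiv ℝ h (0, 0) (1, 0) ∧
    (fderiv ℝ (fun p => fderiv ℝ H p (1, 0)) (0, 0) (1, 0)) *
        (fderiv ℝ (fun p => fderiv ℝ H p (0, 1)) (0, 0) (0, 1)) -
      (fderiv ℝ (fun p => fderiv ℝ H p (1, 0)) (0, 0) (0, 1)) *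
        (fderiv ℝ (fun p => fderiv ℝ H p (0, 1)) (0, 0) (1, 0)) =
      -(fderiv ℝ h (0, 0) (1, 0)) ^ 2 ∧
    (fderiv ℝ h (0, 0) (1, 0) ≠ 0 →
      (fderiv ℝ (fun p => fderiv ℝ H p (1, 0)) (0, 0) (1, 0)) *
          (fderiv ℝ (fun p => fderiv ℝ H p (0, 1)) (0, 0) (0, 1)) -
        (fderiv ℝ (fun p => fderiv ℝ H p (1, 0)) (0, 0) (0, 1)) *
          (fderiv ℝ (fun p => fderiv ℝ H p (0, 1)) (0, 0) (1, 0)) < 0) := by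
  have hHeq : H = fun q : ℝ × ℝ => b2 (q.1, h q) + q.2 * h q := funext fun q => hH q.1 q.2
  have hb' : fderiv ℝ b2 (0, 0) = 0 := clm_prod_eq_zero hb2u hb2v
  have hb2' : ContDiff ℝ 2 b2 := hb2.of_le (WithTop.coe_le_coe.2 le_top : ((2 : ℕ∞) : WithTop ℕ∞) ≤ _)
  have hh' : ContDiff ℝ 2 h := hh.of_le (WithTop.coe_le_coe.2 le_top : ((2 : ℕ∞) : WithTop ℕ∞) ≤ _)
  have hess (w z : ℝ × ℝ) := fderiv_fderiv_height hb2' hh' hb' hh0 w z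
  rw [← hHeq] at hess
  have htt : fderiv ℝ (fun p => fderiv ℝ H p (0, 1)) (0, 0) (0, 1) = 0 := by
    simp only [hess, hht]
    simp [Prod.mk_zero_zero]
  have hut : fderiv ℝ (fun p => fderiv ℝ H p (0, 1)) (0, 0) (1, 0) = fderiv ℝ h (0, 0) (1, 0) := by
    simp only [hess, hht]
    simp [Prod.mk_zero_zero]
  have htu : fderiv ℝ (fun p => fderiv ℝ H p (1, 0)) (0, 0) (0, 1) = fderiv ℝ h (0, 0) (1, 0) := by
    simp only [hess, hht]
    simp [Prod.mk_zero_zero]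
  refine ⟨by simp [hH, hh0, hb20], ?_, htt, hut, ?_, fun hne => ?_⟩
  · ext1 <;> ext1 <;>
      simp [hHeq, fderiv_height (hb2'.differentiable two_ne_zero)
        (hh'.differentiable two_ne_zero), hh0, hb']
  · rw [htt, hut, htu]
    ring
  · rw [htt, hut, htu]
    nlinarith [sq_pos_of_ne_zero hne]
end

section
/- Let b1, b2 : R^2 → R be smooth with, at the origin, b1u = b2u = b2v = 0, b1v ≠ 0 (a parabolic point of the congruence (u,v,b1,b2)), and let η : R^2 → R^3 be the middle surface parametrisation η(u,v) = (b1(u,v), b2(u,v), 0) − (1/2)(b1u + b2v)(u,v)·(u, v, 1). Then the partial derivatives of η at the origin are η_u(0,0) = (0, 0, −(1/2)(b1uu + b2uv)) and η_v(0,0) = (b1v, 0, −(1/2)(b1uv + b2vv)) (second-order partials evaluated at the origin). Consequently: (i) the derivative of η at (0,0) has rank < 2 (the middle surface is singular there) if and only if (b1uu + b2uv)(0,0) = 0; and (ii) the image of the derivative of η at (0,0) is contained in the plane {x ∈ R^3 : x2 = 0}, so at a regular point the middle surface is tangent to the plane x2 = 0, the common tangent plane of the focal surface, along the image of the parabolic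 curve. -/
/-- Mixed second directional derivatives of a `C²` function commute. -/
theorem fderiv_fderiv_apply_comm {E : Type*} [NormedAddCommGroup E] [NormedSpace ℝ E]
    {f : E → ℝ} (hf : ContDiff ℝ 2 f) (x v w : E) :
    fderiv ℝ (fun p => fderiv ℝ f p v) x w = fderiv ℝ (fun p => fderiv ℝ f p w) x v := by
  have hd : DifferentiableAt ℝ (fderiv ℝ f) x :=
    (hf.fderiv_right (m := 1) (by norm_num)).differentiable (by norm_num) x
  have hs : IsSymmSndFDerivAt ℝ f x := hf.contDiffAt.isSymmSndFDerivAt (by simp)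
  rw [fderiv_clm_apply hd (differentiableAt_const v),
    fderiv_clm_apply hd (differentiableAt_const w)]
  simpa using hs.eq w v

/-- The directional derivatives of a smooth function are differentiable. -/
theorem ContDiff.differentiable_fderiv_apply {E : Type*} [NormedAddCommGroup E]
    [NormedSpace ℝ E] {f : E → ℝ} (hf : ContDiff ℝ 2 f) (v : E) :
    Differentiable ℝ (fun p => fderiv ℝ f p v) :=
  ((hf.fderiv_right (m := 1) (by norm_num)).differentiable (by norm_num)).clm_apply
    (differentiable_const v)


/-- At a parabolic point normalised so that `b1u = b2u = b2v = 0`, `b1v ≠ 0` at the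
origin, the middle-surface parametrisation
`η(u,v) = (b1, b2, 0) − (1/2)(b1u + b2v)·(u,v,1)` has partial derivatives
`η_u(0,0) = (0, 0, −(1/2)(b1uu + b2uv))` and `η_v(0,0) = (b1v, 0, −(1/2)(b1uv + b2vv))`;
consequently (i) `η` is singular at the origin iff `(b1uu + b2uv)(0,0) = 0`, and
(ii) the image of the derivative of `η` lies in the plane `{x2 = 0}`, the common
tangent plane of the focal surface. -/
theorem stmt_19 (b1 b2 : ℝ × ℝ → ℝ)
    (hb1 : ContDiff ℝ (⊤ : ℕ∞) b1) (hb2 : ContDiff ℝ (⊤ : ℕ∞) b2)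
    (b1u b1v b2u b2v : ℝ × ℝ → ℝ)
    (hb1u : ∀ p, b1u p = fderiv ℝ b1 p (1, 0)) (hb1v : ∀ p, b1v p = fderiv ℝ b1 p (0, 1))
    (hb2u : ∀ p, b2u p = fderiv ℝ b2 p (1, 0)) (hb2v : ∀ p, b2v p = fderiv ℝ b2 p (0, 1))
    (h1 : b1u (0, 0) = 0) (h2 : b2u (0, 0) = 0) (h3 : b2v (0, 0) = 0)
    (h4 : b1v (0, 0) ≠ 0)
    (η : ℝ × ℝ → ℝ × ℝ × ℝ)
    (hη : ∀ u v : ℝ, η (u, v) =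
      (b1 (u, v) - (1/2) * (b1u (u, v) + b2v (u, v)) * u,
       b2 (u, v) - (1/2) * (b1u (u, v) + b2v (u, v)) * v,
       -(1/2) * (b1u (u, v) + b2v (u, v)))) :
    fderiv ℝ η (0, 0) (1, 0) =
      (0, 0, -(1/2) * (fderiv ℝ b1u (0, 0) (1, 0) + fderiv ℝ b2u (0, 0) (0, 1))) ∧
    fderiv ℝ η (0, 0) (0, 1) =
      (b1v (0, 0), 0,
        -(1/2) * (fderiv ℝ b1u (0, 0) (0, 1) + fderiv ℝ b2v (0, 0) (0, 1))) ∧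
    (¬ Function.Injective (fderiv ℝ η (0, 0)) ↔
      fderiv ℝ b1u (0, 0) (1, 0) + fderiv ℝ b2u (0, 0) (0, 1) = 0) ∧
    Set.range (fun w : ℝ × ℝ => fderiv ℝ η (0, 0) w) ⊆
      {x : ℝ × ℝ × ℝ | x.2.1 = 0} := by
  have hb1' : ContDiff ℝ 2 b1 := contDiff_infty.1 hb1 2
  have hb2' : ContDiff ℝ 2 b2 := contDiff_infty.1 hb2 2
  have hb1u' : b1u = fun p => fderiv ℝ b1 p (1, 0) := funext hb1u
  have hb2u' : b2u = fun p => fderiv ℝ b2 p (1, 0) := funext hb2u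
  have hb2v' : b2v = fun p => fderiv ℝ b2 p (0, 1) := funext hb2v
  have hmixed : fderiv ℝ b2v (0, 0) (1, 0) = fderiv ℝ b2u (0, 0) (0, 1) := by
    rw [hb2u', hb2v']
    exact fderiv_fderiv_apply_comm hb2' _ _ _
  have db1 := (hb1'.differentiable (by norm_num) (0, 0)).hasFDerivAt
  have db2 := (hb2'.differentiable (by norm_num) (0, 0)).hasFDerivAt
  have db1u : HasFDerivAt b1u (fderiv ℝ b1u (0, 0)) (0, 0) :=
    DifferentiableAt.hasFDerivAt (by rw [hb1u']; exact hb1'.differentiable_fderiv_apply _ _)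
  have db2v : HasFDerivAt b2v (fderiv ℝ b2v (0, 0)) (0, 0) :=
    DifferentiableAt.hasFDerivAt (by rw [hb2v']; exact hb2'.differentiable_fderiv_apply _ _)
  have dg := (db1u.add db2v).const_mul (1 / 2 : ℝ)
  have dη := (db1.sub (dg.mul (hasFDerivAt_fst (𝕜 := ℝ) (p := ((0, 0) : ℝ × ℝ))))).prodMk
    ((db2.sub (dg.mul (hasFDerivAt_snd (𝕜 := ℝ) (p := ((0, 0) : ℝ × ℝ))))).prodMk
      ((db1u.add db2v).const_mul (-(1 / 2) : ℝ)))
  have hfderiv := (dη.congr_of_eventuallyEq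
    (Filter.Eventually.of_forall fun p => hη p.1 p.2)).fderiv
  have hu : fderiv ℝ η (0, 0) (1, 0) =
      (0, 0, -(1/2) * (fderiv ℝ b1u (0, 0) (1, 0) + fderiv ℝ b2u (0, 0) (0, 1))) := by
    rw [hfderiv]
    simp [h1, h3, hmixed, ← hb1u, ← hb2u, h2]
    ring
  have hv : fderiv ℝ η (0, 0) (0, 1) =
      (b1v (0, 0), 0,
        -(1/2) * (fderiv ℝ b1u (0, 0) (0, 1) + fderiv ℝ b2v (0, 0) (0, 1))) := by
    rw [hfderiv]
    simp [h1, h3, ← hb1v, ← hb2v]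
    ring
  have hlin : ∀ w : ℝ × ℝ, fderiv ℝ η (0, 0) w =
      w.1 • fderiv ℝ η (0, 0) (1, 0) + w.2 • fderiv ℝ η (0, 0) (0, 1) := by
    intro w
    rw [← map_smul, ← map_smul, ← map_add]
    simp
  refine ⟨hu, hv, ⟨fun hinj => ?_, fun h hinj => ?_⟩, ?_⟩
  · by_contra hne
    refine hinj ((injective_iff_map_eq_zero _).2 fun w hw => ?_)
    rw [hlin, hu, hv] at hw
    simp only [Prod.smul_mk, Prod.mk_add_mk, Prod.mk_eq_zero, smul_eq_mul, mul_zero,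
      zero_add] at hw
    have hw2 : w.2 = 0 := (mul_eq_zero.1 hw.1).resolve_right h4
    have hw1 : w.1 = 0 := by
      have h := hw.2.2
      rw [hw2, zero_mul, add_zero] at h
      exact (mul_eq_zero.1 h).resolve_right (mul_ne_zero (by norm_num) hne)
    exact Prod.ext hw1 hw2
  · have h0 : fderiv ℝ η (0, 0) (1, 0) = fderiv ℝ η (0, 0) 0 := by
      rw [hu, h, map_zero]
      simp
    simpa using hinj h0
  · rintro _ ⟨w, rfl⟩
    simp only [Set.mem_ofPred_eq]
    rw [hlin, hu, hv]
    simp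
end
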